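/- (Theorem 1, first bound.) The squared 2-Wasserstein distance between the posterior conditioned on the full dataset and the posterior conditioned on the dataset without the first observation, integrated over the domain of future predictions, is bounded as ∫_S ∫_{t₀}^{+∞} [(μ_D(x,t) − μ_D̃(x,t))² + (σ_D(x,t) − σ_D̃(x,t))²] dt dx ≤ λ²·(a² + E)·C₁₁ + λ²·Σ_{j=2}^{n} (2a·b_j + c_j)·C_{1j} + λ²·Σ_{i=2}^{n} Σ_{j=2}^{n} (b_i·b_j + M_{ij})·C_{ij}, where a = E·y₁ + G·ỹ, bᵀ = y₁·Hᵀ + ỹᵀ(F − Δ̃⁻¹), cᵀ = G + Hᵀ and M = F − Δ̃⁻¹. -/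

import Mathlib

open Matrix MeasureTheory

/-- `(√x - √y)² ≤ y - x` whenever `x ≤ y`. -/
lemma sqrt_sub_sqrt_sq_le {x y : ℝ} (h : x ≤ y) :
    (Real.sqrt x - Real.sqrt y) ^ 2 ≤ y - x := by
  rcases le_total x 0 with hx | hx
  · rw [Real.sqrt_eq_zero_of_nonpos hx]
    rcases le_total y 0 with hy | hy
    · rw [Real.sqrt_eq_zero_of_nonpos hy]
      linarith
    · nlinarith [Real.sq_sqrt hy]
  · have hs := Real.sqrt_le_sqrt h
    nlinarith [Real.sq_sqrt hx, Real.sq_sqrt (hx.trans h), Real.sqrt_nonneg x]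

/-- Extend a matrix by a zero first row and a zero first column. -/
def zeroBorder {n : ℕ} (A : Matrix (Fin n) (Fin n) ℝ) : Matrix (Fin (n + 1)) (Fin (n + 1)) ℝ :=
  Matrix.of fun i j => Fin.cases 0 (fun i' => Fin.cases 0 (fun j' => A i' j') j) i

section zeroBorder

variable {n : ℕ} (A B : Matrix (Fin n) (Fin n) ℝ)

@[simp] lemma zeroBorder_zero_left (j : Fin (n + 1)) : zeroBorder A 0 j = 0 := rfl

@[simp] lemma zeroBorder_zero_right (i : Fin (n + 1)) : zeroBorder A i 0 = 0 := by
  cases i using Fin.cases <;> rfl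

@[simp] lemma zeroBorder_succ_succ (i j : Fin n) : zeroBorder A i.succ j.succ = A i j := rfl

lemma zeroBorder_mul_mul (D : Matrix (Fin (n + 1)) (Fin (n + 1)) ℝ) :
    zeroBorder A * D * zeroBorder B =
      zeroBorder (A * D.submatrix Fin.succ Fin.succ * B) := by
  ext i j
  cases i using Fin.cases <;> cases j using Fin.cases <;>
    simp [Matrix.mul_apply, Fin.sum_univ_succ]

lemma dotProduct_zeroBorder_mulVec (u v : Fin (n + 1) → ℝ) :
    u ⬝ᵥ zeroBorder A *ᵥ v = (fun i => u (Fin.succ i)) ⬝ᵥ A *ᵥ (fun i => v (Fin.succ i)) := by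
  simp [dotProduct, mulVec, Fin.sum_univ_succ]

lemma zeroBorder_isSymm (hA : A.IsSymm) : (zeroBorder A).IsSymm := by
  ext i j
  cases i using Fin.cases <;> cases j using Fin.cases <;> simp [hA.apply]

end zeroBorder

/-- Conditioning on one more observation increases the explained variance. -/
lemma Matrix.PosDef.dotProduct_inv_sub_zeroBorder_nonneg {n : ℕ}
    {D : Matrix (Fin (n + 1)) (Fin (n + 1)) ℝ} (hD : D.PosDef) (v : Fin (n + 1) → ℝ) :
    0 ≤ v ⬝ᵥ (D⁻¹ - zeroBorder (D.submatrix Fin.succ Fin.succ)⁻¹) *ᵥ v := by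
  set D' := D.submatrix Fin.succ Fin.succ with hD'
  have hD'pd : D'.PosDef := hD.submatrix (Fin.succ_injective n)
  set N := zeroBorder D'⁻¹ with hN
  have hu : IsUnit D.det := (Matrix.isUnit_iff_isUnit_det D).1 hD.isUnit
  have hu' : IsUnit D'.det := (Matrix.isUnit_iff_isUnit_det D').1 hD'pd.isUnit
  have hNDN : N * D * N = N := by
    rw [hN, zeroBorder_mul_mul, ← hD', Matrix.nonsing_inv_mul _ hu', Matrix.one_mul]
  have hQ : (D⁻¹ - N) * D * (D⁻¹ - N) = D⁻¹ - N := by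
    rw [Matrix.sub_mul, Matrix.nonsing_inv_mul _ hu, Matrix.mul_sub, Matrix.sub_mul,
      Matrix.sub_mul, hNDN, Matrix.mul_assoc N D, Matrix.mul_nonsing_inv _ hu]
    simp
  have hsymm : (D⁻¹ - N).IsSymm := by
    refine IsSymm.sub ?_ (zeroBorder_isSymm _ ?_)
    · simpa [IsHermitian, IsSymm, conjTranspose] using hD.isHermitian.inv
    · simpa [IsHermitian, IsSymm, conjTranspose] using hD'pd.isHermitian.inv
  have hnn := hD.posSemidef.dotProduct_mulVec_nonneg ((D⁻¹ - N) *ᵥ v)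
  rw [star_trivial] at hnn
  calc (0 : ℝ) ≤ _ := hnn
    _ = v ⬝ᵥ ((D⁻¹ - N) * D * (D⁻¹ - N)) *ᵥ v := by
      rw [← Matrix.mulVec_mulVec, ← Matrix.mulVec_mulVec, Matrix.dotProduct_mulVec v,
        ← Matrix.mulVec_transpose, hsymm.eq]
    _ = _ := by rw [hQ]

/-- The blocks of the inverse of a positive definite matrix, in terms of its first entry,
the rest of its first row, and the complementary principal submatrix. -/
lemma Matrix.PosDef.inv_blocks {n : ℕ} {D : Matrix (Fin (n + 1)) (Fin (n + 1)) ℝ}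
    (hD : D.PosDef) {δ : ℝ} (hδ : δ ≠ 0) (h00 : D 0 0 = δ) {r : Fin n → ℝ}
    (h0 : ∀ j : Fin n, D 0 j.succ = r j) {D' : Matrix (Fin n) (Fin n) ℝ}
    (hD' : D' = D.submatrix Fin.succ Fin.succ) :
    D⁻¹ 0 0 = (δ - r ⬝ᵥ D'⁻¹ *ᵥ r)⁻¹ ∧
    (∀ j : Fin n, D⁻¹ 0 j.succ = -(D⁻¹ 0 0 • (r ᵥ* D'⁻¹)) j) ∧
    D⁻¹.submatrix Fin.succ Fin.succ = (D' - δ⁻¹ • vecMulVec r r)⁻¹ ∧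
    (∀ i : Fin n, D⁻¹ i.succ 0 =
      -(δ⁻¹ • (D⁻¹.submatrix Fin.succ Fin.succ *ᵥ r)) i) := by
  have hD'pd : D'.PosDef := hD' ▸ hD.submatrix (Fin.succ_injective n)
  have hu : IsUnit D.det := (Matrix.isUnit_iff_isUnit_det D).1 hD.isUnit
  have hu' : IsUnit D'.det := (Matrix.isUnit_iff_isUnit_det D').1 hD'pd.isUnit
  have hsymm : ∀ i j, D i j = D j i := fun i j => by simpa using (hD.isHermitian.apply i j).symm
  have h0' : ∀ j : Fin n, D j.succ 0 = r j := fun j => by rw [hsymm, h0]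
  have hss : ∀ i j : Fin n, D i.succ j.succ = D' i j := fun i j => by rw [hD']; rfl
  have hl := Matrix.nonsing_inv_mul D hu
  have hr := Matrix.mul_nonsing_inv D hu
  set P := D⁻¹
  have hl' : ∀ i j, P i 0 * D 0 j + ∑ l : Fin n, P i l.succ * D l.succ j =
      (1 : Matrix (Fin (n + 1)) (Fin (n + 1)) ℝ) i j := fun i j => by
    rw [← hl, Matrix.mul_apply, Fin.sum_univ_succ]
  have hr' : ∀ i j, D i 0 * P 0 j + ∑ l : Fin n, D i l.succ * P l.succ j =
      (1 : Matrix (Fin (n + 1)) (Fin (n + 1)) ℝ) i j := fun i j => by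
    rw [← hr, Matrix.mul_apply, Fin.sum_univ_succ]
  set p : Fin n → ℝ := fun j => P 0 j.succ with hp
  set R := P.submatrix Fin.succ Fin.succ with hR
  have hpD' : p ᵥ* D' = -(P 0 0 • r) := by
    ext j
    have := hl' 0 j.succ
    simp only [h0, hss, Matrix.one_apply, (Fin.succ_ne_zero j).symm, if_false] at this
    simp only [vecMul, dotProduct, hp, Pi.neg_apply, Pi.smul_apply, smul_eq_mul]
    linarith
  have hpeq : p = -(P 0 0 • (r ᵥ* D'⁻¹)) := by
    have := congrArg (fun v => v ᵥ* D'⁻¹) hpD'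
    simpa [Matrix.vecMul_vecMul, Matrix.mul_nonsing_inv _ hu', Matrix.neg_vecMul,
      Matrix.smul_vecMul] using this
  have h1 : P 0 0 * (δ - r ⬝ᵥ D'⁻¹ *ᵥ r) = 1 := by
    have h2 := hl' 0 0
    simp only [h00, h0', Matrix.one_apply, if_true] at h2
    have h3 : ∑ l : Fin n, P 0 l.succ * r l = p ⬝ᵥ r := rfl
    rw [h3, hpeq, neg_dotProduct, smul_dotProduct, smul_eq_mul, ← Matrix.dotProduct_mulVec] at h2
    linarith
  have hrow : ∀ j, p j = -(δ⁻¹ * ∑ l, r l * R l j) := fun j => by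
    have := hr' 0 j.succ
    simp only [h00, h0, Matrix.one_apply, (Fin.succ_ne_zero j).symm, if_false] at this
    change δ * p j + ∑ l, r l * R l j = 0 at this
    field_simp
    linarith
  refine ⟨eq_inv_of_mul_eq_one_left h1, fun j => congrFun hpeq j, ?_, fun i => ?_⟩
  · refine (Matrix.inv_eq_right_inv ?_).symm
    ext i j
    have := hr' i.succ j.succ
    simp only [h0', hss, Matrix.one_apply, Fin.succ_inj] at this
    change r i * p j + ∑ l, D' i l * R l j = _ at this
    rw [hrow] at this
    rw [Matrix.one_apply, ← this]
    simp only [Matrix.mul_apply, Matrix.sub_apply, Matrix.smul_apply, vecMulVec_apply,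
      smul_eq_mul, sub_mul, Finset.sum_sub_distrib, Finset.mul_sum]
    rw [sub_eq_add_neg, add_comm, ← Finset.sum_neg_distrib, mul_neg, Finset.mul_sum,
      ← Finset.sum_neg_distrib]
    congr 1
    exact Finset.sum_congr rfl fun l _ => by ring
  · have := hl' i.succ 0
    simp only [h00, h0', Matrix.one_apply, Fin.succ_ne_zero i, if_false] at this
    change P i.succ 0 * δ + ∑ l, R i l * r l = 0 at this
    simp only [Pi.smul_apply, smul_eq_mul, mulVec, dotProduct]
    field_simp
    linarith

/-- A nonnegative function dominated by a sum of products of functions of `x` and of `t`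
has iterated integral over a subset at most the full integral of the dominating sum. -/
lemma setIntegral_integral_le_sum_of_le_sum {ι X T : Type*} [Fintype ι] [MeasurableSpace X]
    [MeasurableSpace T] {μ : Measure X} {ν : Measure T} (S : Set X)
    {Φ : X → T → ℝ} (hΦ : ∀ x t, 0 ≤ Φ x t) {w : ι → ℝ} {f : ι → X → ℝ} {g : ι → T → ℝ}
    (hf : ∀ i, Integrable (f i) μ) (hg : ∀ i, Integrable (g i) ν)
    (hle : ∀ x t, Φ x t ≤ ∑ i, w i * (f i x * g i t)) :
    ∫ x in S, ∫ t, Φ x t ∂ν ∂μ ≤ ∑ i, w i * ((∫ x, f i x ∂μ) * ∫ t, g i t ∂ν) := by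
  have hinner : ∀ x, ∫ t, Φ x t ∂ν ≤ ∑ i, w i * (f i x * ∫ t, g i t ∂ν) := fun x => by
    calc ∫ t, Φ x t ∂ν ≤ ∫ t, ∑ i, w i * (f i x * g i t) ∂ν :=
          integral_mono_of_nonneg (.of_forall (hΦ x))
            (integrable_finsetSum _ fun i _ => ((hg i).const_mul _).const_mul _)
            (.of_forall (hle x))
      _ = _ := by
          rw [integral_finsetSum _ fun i _ => ((hg i).const_mul _).const_mul _]
          simp only [integral_const_mul]
  have hint : Integrable (fun x => ∑ i, w i * (f i x * ∫ t, g i t ∂ν)) μ :=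
    integrable_finsetSum _ fun i _ => ((hf i).mul_const _).const_mul _
  have hnn : ∀ x, 0 ≤ ∫ t, Φ x t ∂ν := fun x => integral_nonneg (hΦ x)
  calc ∫ x in S, ∫ t, Φ x t ∂ν ∂μ
      ≤ ∫ x in S, ∑ i, w i * (f i x * ∫ t, g i t ∂ν) ∂μ :=
        integral_mono_of_nonneg (.of_forall hnn) hint.integrableOn (.of_forall hinner)
    _ ≤ ∫ x, ∑ i, w i * (f i x * ∫ t, g i t ∂ν) ∂μ :=
        setIntegral_le_integral hint (.of_forall fun x => (hnn x).trans (hinner x))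
    _ = _ := by
        rw [integral_finsetSum _ fun i _ => ((hf i).mul_const _).const_mul _]
        simp only [integral_const_mul, integral_mul_const]

/-- Translating a set integral over a half-line. -/
lemma setIntegral_Ioi_comp_sub_right (f : ℝ → ℝ) (a c : ℝ) :
    ∫ t in Set.Ioi a, f (t - c) = ∫ τ in Set.Ioi (a - c), f τ := by
  have h := (measurePreserving_sub_right volume c).setIntegral_preimage_emb
    (MeasurableEquiv.subRight c).measurableEmbedding f (Set.Ioi (a - c))
  simpa using h

lemma integrableOn_Ioi_comp_sub_right {f : ℝ → ℝ} {a c : ℝ}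
    (hf : IntegrableOn f (Set.Ioi (a - c))) :
    IntegrableOn (fun t => f (t - c)) (Set.Ioi a) := by
  have h := ((measurePreserving_sub_right volume c).integrableOn_comp_preimage
    (MeasurableEquiv.subRight c).measurableEmbedding (f := f) (s := Set.Ioi (a - c))).2 hf
  simpa [Function.comp_def] using h

/-- Theorem 1, first bound: the squared 2-Wasserstein distance between the posterior
conditioned on the full dataset and the posterior conditioned on the dataset without the
first observation, integrated over the domain of future predictions, is bounded by
`λ²(a²+E)C₁₁ + λ²Σⱼ(2abⱼ+cⱼ)C₁ⱼ + λ²Σᵢⱼ(bᵢbⱼ+Mᵢⱼ)Cᵢⱼ`. -/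
theorem stmt_10
    (d n : ℕ) (hd : 1 ≤ d) (hn : 1 ≤ n)
    (lam sig : ℝ) (hlam : 0 < lam) (hsig : 0 < sig)
    (kS kT : ℝ → ℝ)
    (hkSmeas : Measurable kS) (hkTmeas : Measurable kT)
    (hkSrange : ∀ r, kS r ∈ Set.Icc (0 : ℝ) 1) (hkTrange : ∀ r, kT r ∈ Set.Icc (0 : ℝ) 1)
    (hkS0 : kS 0 = 1) (hkT0 : kT 0 = 1)
    (k : (EuclideanSpace ℝ (Fin d) × ℝ) → (EuclideanSpace ℝ (Fin d) × ℝ) → ℝ)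
    (hk : ∀ p q, k p q = lam * kS (‖p.1 - q.1‖) * kT (|p.2 - q.2|))
    (pts : Fin (n + 1) → EuclideanSpace ℝ (Fin d) × ℝ)
    (y : Fin (n + 1) → ℝ)
    (Δ : Matrix (Fin (n + 1)) (Fin (n + 1)) ℝ)
    (hΔ : ∀ i j, Δ i j = k (pts i) (pts j) + sig ^ 2 * (if i = j then 1 else 0))
    (hPD : Δ.PosDef)
    (Δt : Matrix (Fin n) (Fin n) ℝ)
    (hΔt : Δt = Δ.submatrix Fin.succ Fin.succ)
    (k1 : Fin n → ℝ)
    (hk1 : ∀ j : Fin n, k1 j = k (pts 0) (pts j.succ))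
    (E : ℝ) (hE : E = (lam + sig ^ 2 - k1 ⬝ᵥ Δt⁻¹ *ᵥ k1)⁻¹)
    (F : Matrix (Fin n) (Fin n) ℝ)
    (hF : F = (Δt - (lam + sig ^ 2)⁻¹ • vecMulVec k1 k1)⁻¹)
    (G : Fin n → ℝ) (hG : G = -(E • (k1 ᵥ* Δt⁻¹)))
    (H : Fin n → ℝ) (hH : H = -((lam + sig ^ 2)⁻¹ • (F *ᵥ k1)))
    (μD μDt : (EuclideanSpace ℝ (Fin d) × ℝ) → ℝ)
    (hμD : ∀ p, μD p = (fun i : Fin (n + 1) => k p (pts i)) ⬝ᵥ Δ⁻¹ *ᵥ y)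
    (hμDt : ∀ p, μDt p =
      (fun j : Fin n => k p (pts j.succ)) ⬝ᵥ Δt⁻¹ *ᵥ (fun j : Fin n => y j.succ))
    (σ2D σ2Dt : (EuclideanSpace ℝ (Fin d) × ℝ) → ℝ)
    (hσ2D : ∀ p, σ2D p = lam -
      (fun i : Fin (n + 1) => k p (pts i)) ⬝ᵥ Δ⁻¹ *ᵥ (fun i : Fin (n + 1) => k p (pts i)))
    (hσ2Dt : ∀ p, σ2Dt p = lam -
      (fun j : Fin n => k p (pts j.succ)) ⬝ᵥ Δt⁻¹ *ᵥ (fun j : Fin n => k p (pts j.succ)))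
    (hborder : ∀ p : EuclideanSpace ℝ (Fin d) × ℝ,
      (Matrix.fromBlocks
        (Matrix.of fun (_ : Fin 1) (_ : Fin 1) => lam)
        (Matrix.of fun (_ : Fin 1) (j : Fin (n + 1)) => k p (pts j))
        (Matrix.of fun (i : Fin (n + 1)) (_ : Fin 1) => k p (pts i))
        Δ).PosSemidef)
    (σD σDt : (EuclideanSpace ℝ (Fin d) × ℝ) → ℝ)
    (hσD : ∀ p, σD p = Real.sqrt (σ2D p))
    (hσDt : ∀ p, σDt p = Real.sqrt (σ2Dt p))
    (a : ℝ) (ha : a = E * y 0 + G ⬝ᵥ (fun j : Fin n => y j.succ))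
    (b : Fin n → ℝ)
    (hb : b = y 0 • H + (fun j : Fin n => y j.succ) ᵥ* (F - Δt⁻¹))
    (c : Fin n → ℝ) (hc : c = G + H)
    (M : Matrix (Fin n) (Fin n) ℝ) (hM : M = F - Δt⁻¹)
    (convS : EuclideanSpace ℝ (Fin d) → ℝ)
    (hconvS : ∀ v, convS v = ∫ u : EuclideanSpace ℝ (Fin d), kS ‖u‖ * kS ‖v - u‖)
    (convT : ℝ → ℝ → ℝ)
    (hconvT : ∀ a' s, convT a' s = ∫ τ in Set.Ioi a', kT |τ| * kT |s - τ|)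
    (hintS : ∀ v : EuclideanSpace ℝ (Fin d),
      Integrable (fun u : EuclideanSpace ℝ (Fin d) => kS ‖u‖ * kS ‖v - u‖))
    (hintT : ∀ a' s : ℝ, IntegrableOn (fun τ => kT |τ| * kT |s - τ|) (Set.Ioi a'))
    (t0 : ℝ) (S : Set (EuclideanSpace ℝ (Fin d))) (hS : MeasurableSet S)
    (C : Matrix (Fin (n + 1)) (Fin (n + 1)) ℝ)
    (hC : ∀ i j, C i j =
      convS ((pts j).1 - (pts i).1) * convT (t0 - (pts i).2) ((pts j).2 - (pts i).2)) :
    (∫ x in S, ∫ t in Set.Ioi t0,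
        ((μD (x, t) - μDt (x, t)) ^ 2 + (σD (x, t) - σDt (x, t)) ^ 2))
      ≤ lam ^ 2 * (a ^ 2 + E) * C 0 0 +
        lam ^ 2 * ∑ j : Fin n, (2 * a * b j + c j) * C 0 j.succ +
        lam ^ 2 * ∑ i : Fin n, ∑ j : Fin n, (b i * b j + M i j) * C i.succ j.succ := by
  obtain ⟨hP00, hP0s, hPss, hPs0⟩ := hPD.inv_blocks (δ := lam + sig ^ 2) (by positivity)
    (by simp [hΔ, hk, hkS0, hkT0]) (r := k1)
    (fun j => by simp [hΔ, hk1, (Fin.succ_ne_zero j).symm]) hΔt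
  rw [← hE] at hP00
  rw [← hF] at hPss
  rw [hP00] at hP0s
  rw [hPss] at hPs0
  replace hP0s : ∀ j : Fin n, Δ⁻¹ 0 j.succ = G j := fun j => by rw [hP0s, hG]; rfl
  replace hPs0 : ∀ i : Fin n, Δ⁻¹ i.succ 0 = H i := fun i => by rw [hPs0, hH]; rfl
  replace hPss : ∀ i j : Fin n, Δ⁻¹ i.succ j.succ = F i j := fun i j => by rw [← hPss]; rfl
  have hPsymm : ∀ i j, Δ⁻¹ i j = Δ⁻¹ j i := fun i j => by
    simpa using (hPD.isHermitian.inv.apply i j).symm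
  have hΔtpd : Δt.PosDef := hΔt ▸ hPD.submatrix (Fin.succ_injective n)
  have hMsymm : ∀ i j, M i j = M j i := fun i j => by
    have h := hΔtpd.isHermitian.inv.apply i j
    rw [star_trivial] at h
    rw [hM, Matrix.sub_apply, Matrix.sub_apply, ← hPss, ← hPss, hPsymm, h]
  set Q := Δ⁻¹ - zeroBorder Δt⁻¹ with hQ
  have hQ00 : Q 0 0 = E := by simp [hQ, hP00]
  have hQ0s : ∀ j : Fin n, Q 0 j.succ = G j := fun j => by simp [hQ, hP0s]
  have hQs0 : ∀ j : Fin n, Q j.succ 0 = H j := fun j => by simp [hQ, hPs0]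
  have hQss : ∀ i j : Fin n, Q i.succ j.succ = M i j := fun i j => by simp [hQ, hPss, hM]
  have hw0 : (Q *ᵥ y) 0 = a := by
    simp [mulVec, dotProduct, Fin.sum_univ_succ, hQ00, hQ0s, ha]
  have hws : ∀ j : Fin n, (Q *ᵥ y) j.succ = b j := fun j => by
    rw [hb, ← hM]
    simp only [mulVec, dotProduct, Fin.sum_univ_succ, hQs0, hQss, Pi.add_apply, Pi.smul_apply,
      vecMul, smul_eq_mul]
    congr 1
    · ring
    · exact Finset.sum_congr rfl fun i _ => by rw [hMsymm]; ring
  set w := Q *ᵥ y with hw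
  set fS : Fin (n + 1) × Fin (n + 1) → EuclideanSpace ℝ (Fin d) → ℝ :=
    fun ij x => kS ‖x - (pts ij.1).1‖ * kS ‖x - (pts ij.2).1‖ with hfS
  set fT : Fin (n + 1) × Fin (n + 1) → ℝ → ℝ :=
    fun ij t => kT |t - (pts ij.1).2| * kT |t - (pts ij.2).2| with hfT
  have hfSeq : ∀ i j, fS (i, j) = fun x =>
      (fun u => kS ‖u‖ * kS ‖((pts j).1 - (pts i).1) - u‖) (x - (pts i).1) := fun i j => by
    ext x
    simp only [hfS, sub_sub_sub_cancel_right, norm_sub_rev x (pts j).1]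
  have hfTeq : ∀ i j, fT (i, j) = fun t =>
      (fun τ => kT |τ| * kT |((pts j).2 - (pts i).2) - τ|) (t - (pts i).2) := fun i j => by
    ext t
    simp only [hfT, sub_sub_sub_cancel_right, abs_sub_comm t (pts j).2]
  have hfSint : ∀ ij, Integrable (fS ij) := fun ⟨i, j⟩ => by
    rw [hfSeq]
    exact (hintS _).comp_sub_right _
  have hfTint : ∀ ij, IntegrableOn (fT ij) (Set.Ioi t0) := fun ⟨i, j⟩ => by
    rw [hfTeq]
    exact integrableOn_Ioi_comp_sub_right (hintT _ _)
  have hCeq : ∀ i j, C i j = (∫ x, fS (i, j) x) * ∫ t in Set.Ioi t0, fT (i, j) t := fun i j => by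
    rw [hC, hconvS, hconvT, hfSeq, hfTeq]
    congr 1
    · exact (integral_sub_right_eq_self
        (fun u => kS ‖u‖ * kS ‖((pts j).1 - (pts i).1) - u‖) (pts i).1).symm
    · exact (setIntegral_Ioi_comp_sub_right
        (fun τ => kT |τ| * kT |((pts j).2 - (pts i).2) - τ|) t0 (pts i).2).symm
  have hCsymm : ∀ i j, C i j = C j i := fun i j => by
    rw [hCeq, hCeq]
    simp only [hfS, hfT, mul_comm]
  have hpoint : ∀ x t, (μD (x, t) - μDt (x, t)) ^ 2 + (σD (x, t) - σDt (x, t)) ^ 2 ≤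
      ∑ ij : Fin (n + 1) × Fin (n + 1),
        lam ^ 2 * (w ij.1 * w ij.2 + Q ij.1 ij.2) * (fS ij x * fT ij t) := fun x t => by
    set κ : Fin (n + 1) → ℝ := fun i => k (x, t) (pts i) with hκ
    have hμ : μD (x, t) - μDt (x, t) = κ ⬝ᵥ w := by
      rw [hμD, hμDt, hw, hQ, Matrix.sub_mulVec, dotProduct_sub, dotProduct_zeroBorder_mulVec]
    have hσ : σ2Dt (x, t) - σ2D (x, t) = κ ⬝ᵥ Q *ᵥ κ := by
      rw [hσ2D, hσ2Dt, hQ, Matrix.sub_mulVec, dotProduct_sub, dotProduct_zeroBorder_mulVec]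
      ring
    have hnn : 0 ≤ κ ⬝ᵥ Q *ᵥ κ := by
      rw [hQ, hΔt]
      exact hPD.dotProduct_inv_sub_zeroBorder_nonneg κ
    have hs := sqrt_sub_sqrt_sq_le (x := σ2D (x, t)) (y := σ2Dt (x, t)) (by linarith)
    rw [hσ] at hs
    rw [hμ, hσD, hσDt]
    refine (add_le_add_right hs _).trans_eq ?_
    rw [Fintype.sum_prod_type, sq]
    simp only [dotProduct, mulVec]
    rw [Finset.sum_mul_sum]
    simp only [Finset.mul_sum, ← Finset.sum_add_distrib]
    refine Finset.sum_congr rfl fun i _ => Finset.sum_congr rfl fun j _ => ?_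
    simp only [hκ, hk, hfS, hfT]
    ring
  refine (setIntegral_integral_le_sum_of_le_sum S
    (Φ := fun x t => (μD (x, t) - μDt (x, t)) ^ 2 + (σD (x, t) - σDt (x, t)) ^ 2)
    (fun x t => by positivity) hfSint hfTint hpoint).trans_eq ?_
  simp only [Fintype.sum_prod_type, ← hCeq, Fin.sum_univ_succ, hw0, hws, hQ00, hQ0s, hQs0, hQss,
    Finset.sum_add_distrib]
  simp only [hCsymm (Fin.succ _) 0, hc, Pi.add_apply]
  simp only [add_assoc, Finset.mul_sum]
  rw [← add_assoc (∑ j, _) (∑ j, _), ← Finset.sum_add_distrib]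
  congr 1
  · ring
  · congr 1
    · exact Finset.sum_congr rfl fun j _ => by ring
    · exact Finset.sum_congr rfl fun i _ => Finset.sum_congr rfl fun j _ => by ring
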